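/- There exist a finite tile set T, a seed s ∈ T, a glue function G with all glue strengths at most 5, and two distinct distinguished tiles t₀, t₁ ∈ T (a 'bit-flip gadget'), such that: under the temperature sequence ⟨2⟩ the system ⟨T, s, G, ⟨2⟩⟩ uniquely assembles a supertile S₀, under the temperature sequence ⟨2, 5⟩ the system ⟨T, s, G, ⟨2, 5⟩⟩ uniquely assembles a supertile S₁, the shapes of S₀ and S₁ are identical, and S₀ and S₁ place the same tile at every position except a single position p, at which S₀ places t₀ and S₁ places t₁. -/

import Mathlib

/-! ## The multiple temperature tile self-assembly model -/

/-- Glues are drawn from a countable alphabet; glue `0` is the distinguished `null` glue. -/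
abbrev Glue := ℕ

/-- A tile is a quadruple of glues (north, east, south, west). -/
structure Tile where
  north : Glue
  east : Glue
  south : Glue
  west : Glue
deriving DecidableEq

/-- A configuration maps positions of `ℤ²` to a tile or to `none` (the empty tile). -/
abbrev Config := ℤ × ℤ → Option Tile

/-- Two abutting edges bond with strength `G x` when they carry the same glue `x`,
and with strength `0` otherwise. -/
def bond (G : Glue → ℕ) (x y : Glue) : ℕ := if x = y then G x else 0

/-- Bonding strength between the edges of tile `t` at position `p` and tile `u`
at (neighboring) position `q`. -/
def edgeBond (G : Glue → ℕ) (t u : Tile) (p q : ℤ × ℤ) : ℕ :=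
  if q = (p.1, p.2 + 1) then bond G t.north u.south
  else if q = (p.1 + 1, p.2) then bond G t.east u.west
  else if q = (p.1, p.2 - 1) then bond G t.south u.north
  else if q = (p.1 - 1, p.2) then bond G t.west u.east
  else 0

/-- The four L¹-neighbors of a position. -/
def neighbors (p : ℤ × ℤ) : List (ℤ × ℤ) :=
  [(p.1, p.2 + 1), (p.1 + 1, p.2), (p.1, p.2 - 1), (p.1 - 1, p.2)]

/-- The shape of a configuration: its set of non-empty positions. -/
def shape (C : Config) : Set (ℤ × ℤ) := {p | C p ≠ none}

/-- Total bonding strength between a tile `t` placed at position `p` and the tiles of `C`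
at the four neighboring positions. -/
def attachStrength (G : Glue → ℕ) (C : Config) (t : Tile) (p : ℤ × ℤ) : ℕ :=
  ((neighbors p).map (fun q =>
    match C q with
    | some u => edgeBond G t u p q
    | none => 0)).sum

/-- Bonding strength between the tiles of `C` at adjacent positions `p` and `q`. -/
def bondAt (G : Glue → ℕ) (C : Config) (p q : ℤ × ℤ) : ℕ :=
  match C p, C q with
  | some t, some u => edgeBond G t u p q
  | _, _ => 0

/-- Total strength of the bonds from `p ∈ Q` leaving the set `Q` in configuration `C`. -/
def outStrength (G : Glue → ℕ) (C : Config) (Q : Finset (ℤ × ℤ)) (p : ℤ × ℤ) : ℕ :=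
  (((neighbors p).filter (fun q => q ∉ Q)).map (fun q => bondAt G C p q)).sum

/-- Strength of the cut of (the adjacency graph of) `C` separating `Q` from its complement:
the sum over crossing edges of the bonding strengths of the corresponding abutting edges. -/
def cutStrength (G : Glue → ℕ) (C : Config) (Q : Finset (ℤ × ℤ)) : ℕ :=
  ∑ p ∈ Q, outStrength G C Q p

/-- The initial configuration: the seed tile `s` at the origin. -/
def seedConfig (s : Tile) : Config := fun p => if p = (0, 0) then some s else none

/-- One step of assembly of the (standard) multiple temperature model at temperature `τ`:
either a tile of `T` attaches at an empty position with total bonding strength at least `τ`,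
or the portion `Q` of the supertile on the non-seed side of a cut of strength `< τ`
is removed. -/
inductive Step (T : Finset Tile) (G : Glue → ℕ) (τ : ℕ) : Config → Config → Prop
  | attach (C : Config) (t : Tile) (p : ℤ × ℤ) :
      t ∈ T → C p = none → τ ≤ attachStrength G C t p →
      Step T G τ C (Function.update C p (some t))
  | detach (C : Config) (Q : Finset (ℤ × ℤ)) :
      Q.Nonempty → ((0, 0) : ℤ × ℤ) ∉ Q → (↑Q : Set (ℤ × ℤ)) ⊆ shape C →
      cutStrength G C Q < τ →
      Step T G τ C (fun q => if q ∈ Q then none else C q)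

/-- A configuration is terminal for a step relation if no step applies. -/
def Terminal (step : Config → Config → Prop) (C : Config) : Prop := ∀ D, ¬ step C D

/-- A phase finishes from `C`: there is no infinite sequence of steps starting at `C`. -/
def PhaseTerminates (step : Config → Config → Prop) (C : Config) : Prop :=
  ¬ ∃ f : ℕ → Config, f 0 = C ∧ ∀ n, step (f n) (f (n + 1))

/-- `MultiReach step τs C E`: starting from `C`, running each phase (one per temperature
in `τs`) to a terminal configuration can produce `E`. -/
inductive MultiReach (step : ℕ → Config → Config → Prop) : List ℕ → Config → Config → Prop
  | nil {C : Config} : MultiReach step [] C C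
  | cons {τ : ℕ} {τs : List ℕ} {C D E : Config} :
      Relation.ReflTransGen (step τ) C D → Terminal (step τ) D →
      MultiReach step τs D E → MultiReach step (τ :: τs) C E

/-- Every phase finishes, no matter which additions and removals are chosen. -/
inductive AllFinish (step : ℕ → Config → Config → Prop) : List ℕ → Config → Prop
  | nil {C : Config} : AllFinish step [] C
  | cons {τ : ℕ} {τs : List ℕ} {C : Config} :
      PhaseTerminates (step τ) C →
      (∀ D, Relation.ReflTransGen (step τ) C D → Terminal (step τ) D → AllFinish step τs D) →
      AllFinish step (τ :: τs) C

/-- The tile system with seed `s` and temperature sequence `τs` uniquely produces the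
configuration (supertile) `R`: all phases always finish, and every terminal configuration
produced after the last phase equals `R`. -/
def UniquelyProduces (step : ℕ → Config → Config → Prop) (s : Tile) (τs : List ℕ)
    (R : Config) : Prop :=
  AllFinish step τs (seedConfig s) ∧
  MultiReach step τs (seedConfig s) R ∧
  ∀ C, MultiReach step τs (seedConfig s) C → C = R

/-- Translation of a set of positions by `d`. -/
def translateSet (d : ℤ × ℤ) (S : Set (ℤ × ℤ)) : Set (ℤ × ℤ) := (fun p => p + d) '' S

/-- The system uniquely assembles the shape `Υ` (up to translation). -/
def UniquelyAssembles (step : ℕ → Config → Config → Prop) (s : Tile) (τs : List ℕ)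
    (Υ : Set (ℤ × ℤ)) : Prop :=
  ∃ R : Config, UniquelyProduces step s τs R ∧ ∃ d : ℤ × ℤ, shape R = translateSet d Υ

/-- The `n × n` square shape `{0,…,n−1} × {0,…,n−1}`. -/
def square (n : ℕ) : Set (ℤ × ℤ) :=
  {p : ℤ × ℤ | 0 ≤ p.1 ∧ p.1 < (n : ℤ) ∧ 0 ≤ p.2 ∧ p.2 < (n : ℤ)}

/-- The `a × b` rectangle shape `{0,…,b−1} × {0,…,a−1}` (`b` columns, `a` rows). -/
def rect (a b : ℕ) : Set (ℤ × ℤ) :=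
  {p : ℤ × ℤ | 0 ≤ p.1 ∧ p.1 < (b : ℤ) ∧ 0 ≤ p.2 ∧ p.2 < (a : ℤ)}

/-! ### Auxiliary material -/

namespace BitFlip

def Good (step : Config → Config → Prop) (C F : Config) : Prop :=
  PhaseTerminates step C ∧
    ∀ E, (Relation.ReflTransGen step C E ∧ Terminal step E) ↔ E = F

theorem good_terminal {step : Config → Config → Prop} {C : Config} (h : Terminal step C) :
    Good step C C := by
  refine ⟨?_, ?_⟩
  · rintro ⟨f, h0, hf⟩
    have := hf 0
    rw [h0] at this
    exact h _ this
  · intro E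
    constructor
    · rintro ⟨hr, -⟩
      rcases Relation.ReflTransGen.cases_head hr with h1 | ⟨D, h1, -⟩
      · exact h1.symm
      · exact absurd h1 (h _)
    · rintro rfl
      exact ⟨Relation.ReflTransGen.refl, h⟩

theorem good_step {step : Config → Config → Prop} {C D F : Config} (hs : step C D)
    (hu : ∀ E, step C E → E = D) (h : Good step D F) : Good step C F := by
  refine ⟨?_, ?_⟩
  · rintro ⟨f, h0, hf⟩
    refine h.1 ⟨fun n => f (n + 1), ?_, fun n => hf (n + 1)⟩
    have := hf 0
    rw [h0] at this
    exact hu _ this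
  · intro E
    rw [← h.2 E]
    constructor
    · rintro ⟨hr, ht⟩
      rcases Relation.ReflTransGen.cases_head hr with h1 | ⟨D', h1, h2⟩
      · subst h1
        exact absurd hs (ht _)
      · rw [hu _ h1] at h2
        exact ⟨h2, ht⟩
    · rintro ⟨hr, ht⟩
      exact ⟨Relation.ReflTransGen.head hs hr, ht⟩

theorem unique_one {step : ℕ → Config → Config → Prop} {s : Tile} {a : ℕ} {R : Config}
    (h : Good (step a) (seedConfig s) R) : UniquelyProduces step s [a] R := by
  refine ⟨AllFinish.cons h.1 (fun _ _ _ => AllFinish.nil), ?_, ?_⟩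
  · have := (h.2 R).2 rfl
    exact MultiReach.cons this.1 this.2 MultiReach.nil
  · intro C hC
    cases hC with
    | cons h1 h2 h3 =>
      cases h3
      exact (h.2 _).1 ⟨h1, h2⟩

theorem unique_two {step : ℕ → Config → Config → Prop} {s : Tile} {a b : ℕ} {M R : Config}
    (h : Good (step a) (seedConfig s) M) (h' : Good (step b) M R) :
    UniquelyProduces step s [a, b] R := by
  refine ⟨AllFinish.cons h.1 (fun D h1 h2 => ?_), ?_, ?_⟩
  · rw [(h.2 D).1 ⟨h1, h2⟩]
    exact AllFinish.cons h'.1 (fun _ _ _ => AllFinish.nil)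
  · have h1 := (h.2 M).2 rfl
    have h2 := (h'.2 R).2 rfl
    exact MultiReach.cons h1.1 h1.2 (MultiReach.cons h2.1 h2.2 MultiReach.nil)
  · intro C hC
    cases hC with
    | cons h1 h2 h3 =>
      rw [(h.2 _).1 ⟨h1, h2⟩] at h3
      cases h3 with
      | cons h4 h5 h6 =>
        cases h6
        exact (h'.2 _).1 ⟨h4, h5⟩

/-! List-based configurations -/

abbrev Pos := ℤ × ℤ

def cfg (L : List (Pos × Tile)) : Config := fun q => L.lookup q

theorem cfg_cons (L : List (Pos × Tile)) (p : Pos) (t : Tile) :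
    Function.update (cfg L) p (some t) = cfg ((p, t) :: L) := by
  funext q
  by_cases h : q = p
  · subst h
    simp [cfg]
  · have : (q == p) = false := by simpa using h
    simp [cfg, Function.update_of_ne h, List.lookup_cons, this]

theorem mem_of_cfg (L : List (Pos × Tile)) (q : Pos) (h : cfg L q ≠ none) :
    q ∈ L.map Prod.fst := by
  by_contra hq
  apply h
  simp only [cfg, List.lookup_eq_none_iff]
  intro x hx
  simp only [bne_iff_ne, ne_eq]
  rintro rfl
  exact hq (List.mem_map_of_mem hx)

theorem neighbors_symm {p q : Pos} (h : q ∈ neighbors p) : p ∈ neighbors q := by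
  obtain ⟨a, b⟩ := p
  obtain ⟨c, d⟩ := q
  simp only [neighbors, List.mem_cons, Prod.mk.injEq, List.not_mem_nil, or_false] at h ⊢
  omega

def frontier (L : List (Pos × Tile)) : List Pos := (L.map Prod.fst).flatMap neighbors

theorem mem_frontier (G : Glue → ℕ) (L : List (Pos × Tile)) (t : Tile) (p : Pos)
    (h : attachStrength G (cfg L) t p ≠ 0) : p ∈ frontier L := by
  by_contra hp
  apply h
  unfold attachStrength
  apply List.sum_eq_zero
  intro x hx
  obtain ⟨q, hq, rfl⟩ := List.mem_map.1 hx
  have : cfg L q = none := by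
    by_contra hq'
    exact hp (List.mem_flatMap.2 ⟨q, mem_of_cfg L q hq', neighbors_symm hq⟩)
  simp [this]

/-- Only attachments in `nx` are possible. -/
def AttOK (T : List Tile) (G : Glue → ℕ) (τ : ℕ) (L : List (Pos × Tile))
    (nx : List (Pos × Tile)) : Prop :=
  ∀ p ∈ frontier L, cfg L p = none → ∀ t ∈ T, τ ≤ attachStrength G (cfg L) t p → (p, t) ∈ nx

instance (T : List Tile) (G : Glue → ℕ) (τ : ℕ) (L nx : List (Pos × Tile)) :
    Decidable (AttOK T G τ L nx) := by
  unfold AttOK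
  infer_instance

theorem out_ge (G : Glue → ℕ) (C : Config) (Q : Finset Pos) {p q : Pos}
    (hq : q ∉ Q) (hn : q ∈ neighbors p) : bondAt G C p q ≤ outStrength G C Q p := by
  unfold outStrength
  apply List.single_le_sum (fun _ _ => Nat.zero_le _)
  exact List.mem_map_of_mem (List.mem_filter.2 ⟨hn, by simpa using hq⟩)

theorem cut_ge (G : Glue → ℕ) (C : Config) (Q : Finset Pos) {p q : Pos} (hp : p ∈ Q)
    (hq : q ∉ Q) (hn : q ∈ neighbors p) : bondAt G C p q ≤ cutStrength G C Q :=
  (out_ge G C Q hq hn).trans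
    (Finset.single_le_sum (f := fun p => outStrength G C Q p) (fun _ _ => Nat.zero_le _) hp)

/-- Consecutive positions are bonded with strength at least `τ`. -/
def Linked (G : Glue → ℕ) (τ : ℕ) (C : Config) : List Pos → Prop
  | a :: b :: l => (b ∈ neighbors a ∧ τ ≤ bondAt G C a b ∧ τ ≤ bondAt G C b a) ∧
      Linked G τ C (b :: l)
  | _ => True

instance Linked.dec (G : Glue → ℕ) (τ : ℕ) (C : Config) : ∀ l, Decidable (Linked G τ C l)
  | [] => isTrue trivial
  | [_] => isTrue trivial
  | a :: b :: l =>
    have := Linked.dec G τ C (b :: l)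
    inferInstanceAs (Decidable (_ ∧ _))

theorem linked_iff (G : Glue → ℕ) (τ : ℕ) (C : Config) (Q : Finset Pos)
    (hc : cutStrength G C Q < τ) :
    ∀ (l : List Pos) (a : Pos), Linked G τ C (a :: l) → ∀ b ∈ l, (b ∈ Q ↔ a ∈ Q) := by
  intro l
  induction l with
  | nil => intro a _ b hb; simp at hb
  | cons c l ih =>
    rintro a ⟨⟨hn, h1, h2⟩, h3⟩ b hb
    have hca : c ∈ Q ↔ a ∈ Q := by
      constructor
      · intro hcQ
        by_contra haQ
        have := cut_ge G C Q hcQ haQ (neighbors_symm hn)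
        omega
      · intro haQ
        by_contra hcQ
        have := cut_ge G C Q haQ hcQ hn
        omega
    rcases List.mem_cons.1 hb with rfl | hb
    · exact hca
    · exact (ih c h3 b hb).trans hca

/-! The gadget -/

def G : Glue → ℕ := fun x =>
  if x = 0 then 0 else if x = 2 ∨ x = 3 then 2 else if x ≤ 12 then 5 else if x ≤ 17 then 1 else 0

def sd : Tile := ⟨14, 15, 16, 1⟩
def t0 : Tile := ⟨3, 2, 0, 0⟩
def t1 : Tile := ⟨0, 0, 12, 0⟩

def e0 : Pos × Tile := ((0, 0), sd)
def e1 : Pos × Tile := ((-1, 0), ⟨13, 1, 17, 2⟩)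
def e2 : Pos × Tile := ((-2, 0), t0)
def e3 : Pos × Tile := ((-2, 1), ⟨0, 4, 3, 0⟩)
def e4 : Pos × Tile := ((-1, 1), ⟨0, 5, 13, 4⟩)
def e5 : Pos × Tile := ((0, 1), ⟨0, 6, 14, 5⟩)
def e6 : Pos × Tile := ((1, 1), ⟨0, 0, 7, 6⟩)
def e7 : Pos × Tile := ((1, 0), ⟨7, 0, 8, 15⟩)
def e8 : Pos × Tile := ((1, -1), ⟨8, 0, 0, 9⟩)
def e9 : Pos × Tile := ((0, -1), ⟨16, 9, 0, 10⟩)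
def e10 : Pos × Tile := ((-1, -1), ⟨17, 10, 0, 11⟩)
def e11 : Pos × Tile := ((-2, -1), ⟨12, 11, 0, 0⟩)
def e12 : Pos × Tile := ((-2, 0), t1)

def TL : List Tile := [e0, e1, e2, e3, e4, e5, e6, e7, e8, e9, e10, e11, e12].map Prod.snd

def T : Finset Tile := TL.toFinset

/-- The ring of positions. -/
def ring : List Pos :=
  [(-2, -1), (-1, -1), (0, -1), (1, -1), (1, 0), (1, 1), (0, 1), (-1, 1), (-2, 1)]

def LM : List (Pos × Tile) := [e11, e10, e9, e8, e7, e6, e5, e4, e3, e1, e0]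
def L0 : List (Pos × Tile) := [e11, e10, e9, e8, e7, e6, e5, e4, e3, e2, e1, e0]
def L1 : List (Pos × Tile) := e12 :: LM

/-- No detachment at temperature 2 from a linear chain ending at the origin. -/
theorem no_detach {τ : ℕ} (L : List (Pos × Tile)) (e : Pos × Tile)
    (hl : Linked G τ (cfg (e :: L)) ((e :: L).map Prod.fst))
    (h0 : ((0, 0) : Pos) ∈ (e :: L).map Prod.fst)
    (Q : Finset Pos) (hQ : Q.Nonempty) (hz : ((0, 0) : Pos) ∉ Q)
    (hs : (↑Q : Set Pos) ⊆ shape (cfg (e :: L))) (hc : cutStrength G (cfg (e :: L)) Q < τ) :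
    False := by
  have key := linked_iff G τ _ Q hc _ _ hl
  have key' : ∀ b ∈ (e :: L).map Prod.fst, (b ∈ Q ↔ e.1 ∈ Q) := by
    intro b hb
    rcases List.mem_cons.1 hb with rfl | hb
    · rfl
    · exact key b hb
  obtain ⟨q, hq⟩ := hQ
  have h1 := (key' q (mem_of_cfg _ _ (hs hq))).1 hq
  exact hz ((key' _ h0).2 h1)

theorem att {τ : ℕ} (hτ : 0 < τ) {L nx : List (Pos × Tile)} (h : AttOK TL G τ L nx)
    {t : Tile} {p : Pos} (ht : t ∈ T) (hp : cfg L p = none)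
    (ha : τ ≤ attachStrength G (cfg L) t p) : (p, t) ∈ nx :=
  h p (mem_frontier G L t p (by omega)) hp t (List.mem_toFinset.1 ht) ha

theorem grow (L : List (Pos × Tile)) (e e' : Pos × Tile) (F : Config)
    (h : e'.2 ∈ TL ∧ cfg (e :: L) e'.1 = none ∧ 2 ≤ attachStrength G (cfg (e :: L)) e'.2 e'.1 ∧
      AttOK TL G 2 (e :: L) [e'] ∧
      Linked G 2 (cfg (e :: L)) ((e :: L).map Prod.fst) ∧
      ((0, 0) : Pos) ∈ (e :: L).map Prod.fst)
    (hg : Good (Step T G 2) (cfg (e' :: e :: L)) F) : Good (Step T G 2) (cfg (e :: L)) F := by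
  obtain ⟨h1, h2, h3, h4, h5, h6⟩ := h
  refine good_step ?_ ?_ hg
  · have hc := cfg_cons (e :: L) e'.1 e'.2
    change _ = cfg (e' :: e :: L) at hc
    rw [← hc]
    exact Step.attach _ _ _ (List.mem_toFinset.2 h1) h2 h3
  · intro E hE
    cases hE with
    | attach t p ht hp ha =>
      have := att (by norm_num) h4 ht hp ha
      rw [cfg_cons, List.mem_singleton.1 this]
    | detach Q hQ hz hs hc => exact (no_detach L e h5 h6 Q hQ hz hs hc).elim

theorem seed_eq : seedConfig sd = cfg [e0] := by
  funext q
  by_cases h : q = (0, 0)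
  · subst h; rfl
  · have : (q == ((0, 0) : Pos)) = false := by simpa using h
    simp [seedConfig, cfg, e0, h, List.lookup_cons, this]

theorem term0 : Terminal (Step T G 2) (cfg L0) := by
  intro E hE
  have h4 : AttOK TL G 2 L0 [] := by decide +kernel
  have h5 : Linked G 2 (cfg L0) (L0.map Prod.fst) := by decide +kernel
  cases hE with
  | attach t p ht hp ha => simpa using att (by norm_num) h4 ht hp ha
  | detach Q hQ hz hs hc => exact (no_detach _ _ h5 (by decide) Q hQ hz hs hc).elim

theorem phase1 : Good (Step T G 2) (seedConfig sd) (cfg L0) := by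
  rw [seed_eq]
  apply grow [] e0 e1 _ (by decide +kernel)
  apply grow _ _ e2 _ (by decide +kernel)
  apply grow _ _ e3 _ (by decide +kernel)
  apply grow _ _ e4 _ (by decide +kernel)
  apply grow _ _ e5 _ (by decide +kernel)
  apply grow _ _ e6 _ (by decide +kernel)
  apply grow _ _ e7 _ (by decide +kernel)
  apply grow _ _ e8 _ (by decide +kernel)
  apply grow _ _ e9 _ (by decide +kernel)
  apply grow _ _ e10 _ (by decide +kernel)
  apply grow _ _ e11 _ (by decide +kernel)
  exact good_terminal term0

/-- A weak cut at temperature 5 can only involve the flip position. -/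
theorem weak_cut (L : List (Pos × Tile))
    (hr : Linked G 5 (cfg L) ring) (hw : Linked G 5 (cfg L) [(0, 0), (-1, 0)])
    (hp : ∀ q ∈ L.map Prod.fst, q ∈ ring ∨ q = (0, 0) ∨ q = (-1, 0) ∨ q = (-2, 0))
    (hb : 1 ≤ bondAt G (cfg L) (-1, -1) (-1, 0) ∧ 1 ≤ bondAt G (cfg L) (0, -1) (0, 0) ∧
      1 ≤ bondAt G (cfg L) (1, 0) (0, 0) ∧ 1 ≤ bondAt G (cfg L) (0, 1) (0, 0) ∧
      1 ≤ bondAt G (cfg L) (-1, 1) (-1, 0))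
    (Q : Finset Pos) (hz : ((0, 0) : Pos) ∉ Q)
    (hs : (↑Q : Set Pos) ⊆ shape (cfg L)) (hc : cutStrength G (cfg L) Q < 5) :
    (∀ q ∈ Q, q = (-2, 0)) ∧ ((-2, -1) : Pos) ∉ Q := by
  have kr := linked_iff G 5 _ Q hc _ _ hr
  have kw : ((-1, 0) : Pos) ∉ Q := fun h =>
    hz ((linked_iff G 5 _ Q hc _ _ hw (-1, 0) (by decide)).1 h)
  have hZ : ((-2, -1) : Pos) ∉ Q := by
    intro hZ
    obtain ⟨b1, b2, b3, b4, b5⟩ := hb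
    let K : Finset Pos := {(-1, -1), (0, -1), (1, 0), (0, 1), (-1, 1)}
    have hK : K ⊆ Q := by
      intro x hx
      simp only [K, Finset.mem_insert, Finset.mem_singleton] at hx
      apply (kr x _).2 hZ
      rcases hx with rfl | rfl | rfl | rfl | rfl <;> decide
    have h1 : ∀ x ∈ K, 1 ≤ outStrength G (cfg L) Q x := by
      intro x hx
      simp only [K, Finset.mem_insert, Finset.mem_singleton] at hx
      rcases hx with rfl | rfl | rfl | rfl | rfl
      · exact b1.trans (out_ge _ _ _ kw (by decide))
      · exact b2.trans (out_ge _ _ _ hz (by decide))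
      · exact b3.trans (out_ge _ _ _ hz (by decide))
      · exact b4.trans (out_ge _ _ _ hz (by decide))
      · exact b5.trans (out_ge _ _ _ kw (by decide))
    have h2 : K.card • 1 ≤ ∑ x ∈ K, outStrength G (cfg L) Q x := Finset.card_nsmul_le_sum _ _ _ h1
    have h3 : ∑ x ∈ K, outStrength G (cfg L) Q x ≤ cutStrength G (cfg L) Q :=
      Finset.sum_le_sum_of_subset hK
    have h4 : K.card = 5 := by decide
    simp only [h4, smul_eq_mul] at h2
    omega
  refine ⟨?_, hZ⟩
  intro q hq
  rcases hp q (mem_of_cfg _ _ (hs hq)) with h | rfl | rfl | rfl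
  · exfalso
    rcases List.mem_cons.1 h with rfl | h
    · exact hZ hq
    · exact hZ ((kr q h).1 hq)
  · exact absurd hq hz
  · exact absurd hq kw
  · rfl

theorem removed : (fun q => if q ∈ ({(-2, 0)} : Finset Pos) then none else cfg L0 q) = cfg LM := by
  funext q
  by_cases h : q = (-2, 0)
  · subst h; decide
  · have : (q == ((-2, 0) : Pos)) = false := by simpa using h
    simp only [Finset.mem_singleton, h, if_false, cfg, L0, LM, e0, e1, e2, e3, e4, e5, e6, e7, e8, e9, e10, e11,
      List.lookup_cons, this]

theorem agree (q : Pos) (h : q ≠ (-2, 0)) : cfg L0 q = cfg L1 q := by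
  have : (q == ((-2, 0) : Pos)) = false := by simpa using h
  simp only [cfg, L0, L1, LM, e0, e1, e2, e3, e4, e5, e6, e7, e8, e9, e10, e11, e12, List.lookup_cons, this]

theorem term1 : Terminal (Step T G 5) (cfg L1) := by
  intro E hE
  have h4 : AttOK TL G 5 L1 [] := by decide +kernel
  cases hE with
  | attach t p ht hp ha => simpa using att (by norm_num) h4 ht hp ha
  | detach Q hQ hz hs hc =>
    obtain ⟨h1, h2⟩ := weak_cut L1 (by decide +kernel) (by decide +kernel) (by decide +kernel)
      (by decide +kernel) Q hz hs hc
    obtain ⟨q, hq⟩ := hQ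
    have hq' := h1 q hq
    subst hq'
    have hl : Linked G 5 (cfg L1) [(-2, -1), (-2, 0)] := by decide +kernel
    exact h2 ((linked_iff G 5 _ Q hc _ _ hl (-2, 0) (by decide)).1 hq)

theorem phase2 : Good (Step T G 5) (cfg L0) (cfg L1) := by
  have hM : Good (Step T G 5) (cfg LM) (cfg L1) := by
    refine good_step (D := cfg L1) ?_ ?_ (good_terminal term1)
    · show Step T G 5 (cfg LM) (cfg (((-2, 0), t1) :: LM))
      rw [← cfg_cons]
      exact Step.attach _ _ _ (by decide) (by decide) (by decide +kernel)
    · intro E hE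
      have h4 : AttOK TL G 5 LM [e12] := by decide +kernel
      cases hE with
      | attach t p ht hp ha =>
        have := att (by norm_num) h4 ht hp ha
        rw [cfg_cons, List.mem_singleton.1 this]
        rfl
      | detach Q hQ hz hs hc =>
        obtain ⟨h1, h2⟩ := weak_cut LM (by decide +kernel) (by decide +kernel) (by decide +kernel)
          (by decide +kernel) Q hz hs hc
        obtain ⟨q, hq⟩ := hQ
        have hq' := h1 q hq
        subst hq'
        exact absurd (by decide) (hs hq)
  refine good_step (D := cfg LM) ?_ ?_ hM
  · rw [← removed]
    refine Step.detach _ _ (by simp) (by decide) ?_ (by decide +kernel)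
    intro q hq
    have : q = (-2, 0) := by simpa using hq
    subst this
    show cfg L0 (-2, 0) ≠ none
    decide
  · intro E hE
    have h4 : AttOK TL G 5 L0 [] := by decide +kernel
    cases hE with
    | attach t p ht hp ha => exact absurd (att (by norm_num) h4 ht hp ha) (by simp)
    | detach Q hQ hz hs hc =>
      obtain ⟨h1, h2⟩ := weak_cut L0 (by decide +kernel) (by decide +kernel) (by decide +kernel)
        (by decide +kernel) Q hz hs hc
      have hQ' : Q = {(-2, 0)} := Finset.eq_singleton_iff_nonempty_unique_mem.2 ⟨hQ, h1⟩
      subst hQ'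
      exact removed

theorem G_le (x : Glue) : G x ≤ 5 := by
  unfold G
  split_ifs <;> omega

end BitFlip

/-- **bit-flip gadget.** There are a finite tile set `T`, seed `s ∈ T`, glue
function `G` with strengths at most 5, and distinct distinguished tiles `t₀, t₁ ∈ T`, such
that under temperature sequence `⟨2⟩` the system uniquely assembles a supertile `S₀`, under
`⟨2, 5⟩` it uniquely assembles a supertile `S₁`, the shapes of `S₀` and `S₁` coincide, and
`S₀` and `S₁` agree everywhere except at a single position `p`, where `S₀` places `t₀`
and `S₁` places `t₁`. -/
theorem stmt6 :
    ∃ (T : Finset Tile) (s : Tile) (G : Glue → ℕ) (t₀ t₁ : Tile),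
      s ∈ T ∧ t₀ ∈ T ∧ t₁ ∈ T ∧ t₀ ≠ t₁ ∧ G 0 = 0 ∧ (∀ x, G x ≤ 5) ∧
      ∃ S₀ S₁ : Config,
        UniquelyProduces (Step T G) s [2] S₀ ∧
        UniquelyProduces (Step T G) s [2, 5] S₁ ∧
        shape S₀ = shape S₁ ∧
        ∃ p : ℤ × ℤ, S₀ p = some t₀ ∧ S₁ p = some t₁ ∧
          ∀ q : ℤ × ℤ, q ≠ p → S₀ q = S₁ q := by
  refine ⟨BitFlip.T, BitFlip.sd, BitFlip.G, BitFlip.t0, BitFlip.t1, by decide, by decide,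
    by decide, by decide, rfl, BitFlip.G_le, BitFlip.cfg BitFlip.L0, BitFlip.cfg BitFlip.L1,
    BitFlip.unique_one BitFlip.phase1, BitFlip.unique_two BitFlip.phase1 BitFlip.phase2,
    ?_, (-2, 0), by decide, by decide, BitFlip.agree⟩
  ext q
  by_cases h : q = (-2, 0)
  · subst h
    have h0 : BitFlip.cfg BitFlip.L0 (-2, 0) ≠ none := by decide
    have h1 : BitFlip.cfg BitFlip.L1 (-2, 0) ≠ none := by decide
    exact ⟨fun _ => h1, fun _ => h0⟩
  · simp only [shape, Set.mem_ofPred_eq, BitFlip.agree q h]
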